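/- Let (M, σ_M) and (N, σ_N) be free Γ-modules and B : M × N → ℤ a Γ-equivariant ℤ-bilinear map (B(σ_M(x), σ_N(y)) = B(x, y)) that is nondegenerate. Then there exist an integer m ≥ 0, positive integers r_1, …, r_m with primitive r_i-th roots of unity ζ_{r_i} ∈ 𝓞_{r_i} = ℤ[ζ_{r_i}], such that, setting R = ⨁_{i=1}^m 𝓞_{r_i} with the automorphism δ acting by multiplication by ζ_{r_i} on the i-th summand, there are injective ℤ-linear maps with finite cokernel ψ_1 : R → M and ψ_2 : N → Hom_ℤ(R, ℤ) satisfying: ψ_1 ∘ δ = σ_M ∘ ψ_1; ψ_2(σ_N(y)) = ψ_2(y) ∘ δ^{-1} for all y ∈ N (equivariance for the dual action (γf)(x) = f(γ^{-1}x)); and B(ψ_1(x), y) = ψ_2(y)(x) for all x ∈ R, y ∈ N. That is, every nondegenerate Γ-equivariant lattice pairing is isogenous to (R, Hom_ℤ(R, ℤ)) with the natural evaluation pairing. -/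

import Mathlib

open Polynomial

section PolynomialModule

variable {P : Type*} [AddCommGroup P] [Module ℤ[X] P]

/-- The `ℤ`-saturation of a `ℤ[X]`-submodule `A`: the elements with a nonzero integral multiple
in `A`. -/
def Submodule.intSaturation (A : Submodule ℤ[X] P) : Submodule ℤ[X] P where
  carrier := {v | ∃ c : ℤ, c ≠ 0 ∧ c • v ∈ A}
  zero_mem' := ⟨1, one_ne_zero, by simp⟩
  add_mem' := by
    rintro v w ⟨c, hc, hv⟩ ⟨d, hd, hw⟩
    refine ⟨c * d, mul_ne_zero hc hd, ?_⟩
    rw [smul_add]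
    refine A.add_mem ?_ ?_
    · rw [mul_comm, mul_smul]
      exact zsmul_mem hv d
    · rw [mul_smul]
      exact zsmul_mem hw c
  smul_mem' := by
    rintro p v ⟨c, hc, hv⟩
    refine ⟨c, hc, ?_⟩
    rw [smul_comm]
    exact A.smul_mem p hv

theorem Submodule.mem_intSaturation {A : Submodule ℤ[X] P} {v : P} :
    v ∈ A.intSaturation ↔ ∃ c : ℤ, c ≠ 0 ∧ c • v ∈ A := Iff.rfl

theorem Submodule.le_intSaturation (A : Submodule ℤ[X] P) : A ≤ A.intSaturation :=
  fun v hv => ⟨1, one_ne_zero, by simpa using hv⟩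

theorem Submodule.mem_intSaturation_of_zsmul_mem {A : Submodule ℤ[X] P} {v : P} {c : ℤ}
    (hc : c ≠ 0) (h : c • v ∈ A.intSaturation) : v ∈ A.intSaturation := by
  obtain ⟨d, hd, h⟩ := h
  exact ⟨d * c, mul_ne_zero hd hc, by rwa [mul_smul]⟩

/-- An ideal of `ℤ[X]` generating the unit ideal of `ℚ[X]` contains a nonzero integer. -/
theorem Ideal.exists_C_mem_of_one_mem_map {K : Ideal ℤ[X]}
    (h : (1 : ℚ[X]) ∈ K.map (mapRingHom (Int.castRingHom ℚ))) :
    ∃ c : ℤ, c ≠ 0 ∧ C c ∈ K := by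
  let := Polynomial.algebra ℤ ℚ
  have := Polynomial.isLocalization (nonZeroDivisors ℤ) ℚ
  obtain ⟨⟨a, m⟩, ham⟩ := (IsLocalization.mem_map_algebraMap_iff
    (Submonoid.map (C : ℤ →+* ℤ[X]) (nonZeroDivisors ℤ)) ℚ[X]).1 h
  obtain ⟨c, hc, hcm⟩ := m.2
  refine ⟨c, nonZeroDivisors.ne_zero hc, ?_⟩
  have hma : (m : ℤ[X]) = a := by
    apply map_injective (Int.castRingHom ℚ) Int.cast_injective
    rw [one_mul] at ham
    exact ham
  have hcm' : C c = (m : ℤ[X]) := hcm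
  rw [hcm', hma]
  exact a.2

/-- The ideal of polynomials carrying `v` into the saturation of `A` stays proper over `ℚ`, unless
`v` itself is in the saturation. -/
theorem Submodule.mem_intSaturation_of_one_mem_map {A : Submodule ℤ[X] P} {v : P}
    (h : (1 : ℚ[X]) ∈ Ideal.map (mapRingHom (Int.castRingHom ℚ))
      (A.intSaturation.comap (LinearMap.toSpanSingleton ℤ[X] P v))) :
    v ∈ A.intSaturation := by
  obtain ⟨c, hc, hcK⟩ := Ideal.exists_C_mem_of_one_mem_map h
  refine Submodule.mem_intSaturation_of_zsmul_mem hc ?_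
  rw [← Int.cast_smul_eq_zsmul ℤ[X]]
  simpa using hcK

theorem exists_cyclotomic_smul_eq_zero_notMem {A : Submodule ℤ[X] P} {n : ℕ} (hn : 0 < n) {v : P}
    (hv : (X ^ n - 1 : ℤ[X]) • v = 0) (hvA : v ∉ A.intSaturation) :
    ∃ (r : ℕ+) (w : P), cyclotomic r ℤ • w = 0 ∧ w ∉ A.intSaturation := by
  by_contra! hcon
  apply hvA
  apply Submodule.mem_intSaturation_of_one_mem_map
  obtain ⟨μ, hμ⟩ := (exists_sum_eq_one_iff_pairwise_coprime
    (s := fun i => cyclotomic i ℚ) (Nat.nonempty_divisors.2 hn.ne')).2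
    (fun i j hij => cyclotomic.isCoprime_rat (Subtype.coe_injective.ne hij))
  rw [← hμ]
  refine Ideal.sum_mem _ fun d hd => Ideal.mul_mem_left _ _ ?_
  have hmap : ∏ j ∈ n.divisors \ {d}, cyclotomic j ℚ =
      mapRingHom (Int.castRingHom ℚ) (∏ j ∈ n.divisors \ {d}, cyclotomic j ℤ) := by
    simp
  rw [hmap]
  apply Ideal.mem_map_of_mem
  refine hcon ⟨d, Nat.pos_of_mem_divisors hd⟩ _ ?_
  rw [LinearMap.toSpanSingleton_apply, smul_smul, PNat.mk_coe, mul_comm,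
    Finset.sdiff_singleton_eq_erase, Finset.prod_erase_mul _ _ hd,
    prod_cyclotomic_eq_X_pow_sub_one hn, hv]

theorem cyclotomic_dvd_of_smul_mem_intSaturation {A : Submodule ℤ[X] P} {r : ℕ+} {w : P}
    (hw : cyclotomic r ℤ • w = 0) (hwA : w ∉ A.intSaturation) {p : ℤ[X]}
    (hp : p • w ∈ A.intSaturation) : cyclotomic r ℤ ∣ p := by
  by_contra hdvd
  apply hwA
  apply Submodule.mem_intSaturation_of_one_mem_map
  have hdvd' : ¬ cyclotomic r ℚ ∣ p.map (Int.castRingHom ℚ) := by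
    rwa [← map_cyclotomic_int, map_dvd_map _ Int.cast_injective (cyclotomic.monic _ _)]
  obtain ⟨a, b, hab⟩ := ((cyclotomic.irreducible_rat r.pos).coprime_iff_not_dvd).2 hdvd'
  rw [← hab]
  refine Ideal.add_mem _ (Ideal.mul_mem_left _ _ ?_) (Ideal.mul_mem_left _ _ ?_)
  · rw [← map_cyclotomic_int]
    refine Ideal.mem_map_of_mem (mapRingHom (Int.castRingHom ℚ)) ?_
    simp [hw]
  · exact Ideal.mem_map_of_mem (mapRingHom (Int.castRingHom ℚ)) hp

/-- A family generating a direct sum of copies of the `ℤ[X] / (Φ_{r i})`. -/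
def IsCyclotomicFamily {m : ℕ} (r : Fin m → ℕ+) (w : Fin m → P) : Prop :=
  (∀ i, cyclotomic (r i) ℤ • w i = 0) ∧
    ∀ p : Fin m → ℤ[X], ∑ i, p i • w i = 0 → ∀ i, cyclotomic (r i) ℤ ∣ p i

theorem IsCyclotomicFamily.linearIndependent {m : ℕ} {r : Fin m → ℕ+} {w : Fin m → P}
    (h : IsCyclotomicFamily r w) : LinearIndependent ℤ w := by
  rw [Fintype.linearIndependent_iff]
  intro g hg i
  by_contra hgi
  have hdvd := h.2 (fun i => C (g i)) (by simpa [Int.cast_smul_eq_zsmul] using hg) i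
  have hdeg := natDegree_le_of_dvd hdvd (by simpa using hgi)
  rw [natDegree_C, natDegree_cyclotomic] at hdeg
  exact (Nat.totient_pos.2 (r i).pos).not_ge hdeg

theorem IsCyclotomicFamily.cons {m : ℕ} {r : Fin m → ℕ+} {w : Fin m → P}
    (h : IsCyclotomicFamily r w) {s : ℕ+} {v : P} (hv : cyclotomic s ℤ • v = 0)
    (hvA : v ∉ (Submodule.span ℤ[X] (Set.range w)).intSaturation) :
    IsCyclotomicFamily (Fin.cons s r : Fin (m + 1) → ℕ+) (Fin.cons v w : Fin (m + 1) → P) := by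
  refine ⟨Fin.cases (by simpa using hv) (by simpa using h.1), fun p hp => ?_⟩
  simp only [Fin.sum_univ_succ, Fin.cons_zero, Fin.cons_succ] at hp
  have hdvd : cyclotomic s ℤ ∣ p 0 := by
    refine cyclotomic_dvd_of_smul_mem_intSaturation hv hvA (Submodule.le_intSaturation _ ?_)
    rw [eq_neg_of_add_eq_zero_left hp]
    exact Submodule.neg_mem _ (Submodule.sum_mem _ fun i _ =>
      Submodule.smul_mem _ _ (Submodule.subset_span (Set.mem_range_self i)))
  have hzero : p 0 • v = 0 := by
    obtain ⟨q, hq⟩ := hdvd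
    rw [hq, mul_comm, mul_smul, hv, smul_zero]
  rw [hzero, zero_add] at hp
  exact Fin.cases (by simpa using hdvd) (by simpa using h.2 _ hp)

theorem exists_isCyclotomicFamily_intSaturation_eq_top [Module.Finite ℤ P] {n : ℕ} (hn : 0 < n)
    (h : ∀ v : P, (X ^ n - 1 : ℤ[X]) • v = 0) :
    ∃ (m : ℕ) (r : Fin m → ℕ+) (w : Fin m → P), IsCyclotomicFamily r w ∧
      (Submodule.span ℤ[X] (Set.range w)).intSaturation = ⊤ := by
  classical
  let Q : ℕ → Prop := fun m => ∃ (r : Fin m → ℕ+) (w : Fin m → P), IsCyclotomicFamily r w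
  have hQ0 : Q 0 := ⟨Fin.elim0, Fin.elim0, fun i => i.elim0, fun _ _ i => i.elim0⟩
  have hbound : ∀ m, Q m → m ≤ Module.finrank ℤ P := by
    rintro m ⟨r, w, hw⟩
    simpa using hw.linearIndependent.fintype_card_le_finrank
  obtain ⟨r, w, hw⟩ : Q (Nat.findGreatest Q (Module.finrank ℤ P)) :=
    Nat.findGreatest_spec (Nat.zero_le _) hQ0
  refine ⟨_, r, w, hw, ?_⟩
  by_contra htop
  obtain ⟨v, -, hv⟩ := SetLike.exists_of_lt (lt_top_iff_ne_top.2 htop)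
  obtain ⟨s, u, hu, huA⟩ := exists_cyclotomic_smul_eq_zero_notMem hn (h v) hv
  have hQ : Q (Nat.findGreatest Q (Module.finrank ℤ P) + 1) := ⟨_, _, hw.cons hu huA⟩
  exact (Nat.lt_succ_self _).not_ge (Nat.le_findGreatest (hbound _ hQ) hQ)

end PolynomialModule

section RingOfIntegers

open NumberField

instance isCyclotomicExtension_cyclotomicField_pnat (r : ℕ+) :
    IsCyclotomicExtension {(r : ℕ)} ℚ (CyclotomicField r ℚ) :=
  have : NeZero ((r : ℕ) : ℚ) := ⟨Nat.cast_ne_zero.2 r.ne_zero⟩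
  CyclotomicField.isCyclotomicExtension _ _

/-- A primitive `r`-th root of unity in the ring of integers of the `r`-th cyclotomic field. -/
noncomputable def cyclotomicInteger (r : ℕ+) : 𝓞 (CyclotomicField r ℚ) :=
  (IsCyclotomicExtension.zeta_spec (r : ℕ) ℚ (CyclotomicField r ℚ)).toInteger

theorem isPrimitiveRoot_cyclotomicInteger (r : ℕ+) :
    IsPrimitiveRoot (cyclotomicInteger r) (r : ℕ) :=
  (IsCyclotomicExtension.zeta_spec (r : ℕ) ℚ (CyclotomicField r ℚ)).toInteger_isPrimitiveRoot

theorem aeval_cyclotomicInteger_surjective (r : ℕ+) :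
    Function.Surjective (aeval (R := ℤ) (cyclotomicInteger r)) := by
  intro x
  have hζ := IsCyclotomicExtension.zeta_spec (r : ℕ) ℚ (CyclotomicField r ℚ)
  obtain ⟨p, hp⟩ := hζ.integralPowerBasis.exists_eq_aeval' x
  rw [hζ.integralPowerBasis_gen] at hp
  exact ⟨p, hp.symm⟩

theorem aeval_cyclotomicInteger_eq_zero_iff (r : ℕ+) (p : ℤ[X]) :
    aeval (cyclotomicInteger r) p = 0 ↔ cyclotomic r ℤ ∣ p := by
  have hζ := isPrimitiveRoot_cyclotomicInteger r
  rw [cyclotomic_eq_minpoly (hζ.map_of_injective RingOfIntegers.coe_injective) r.pos,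
    minpoly.algebraMap_eq RingOfIntegers.coe_injective,
    minpoly.isIntegrallyClosed_dvd_iff (hζ.isIntegral r.pos)]

theorem exists_linearMap_aeval_cyclotomicInteger {P : Type*} [AddCommGroup P] [Module ℤ[X] P]
    (r : ℕ+) {w : P} (hw : cyclotomic r ℤ • w = 0) :
    ∃ g : 𝓞 (CyclotomicField r ℚ) →ₗ[ℤ] P, ∀ p : ℤ[X], g (aeval (cyclotomicInteger r) p) = p • w := by
  let q : ℤ[X] → 𝓞 (CyclotomicField r ℚ) := aeval (cyclotomicInteger r)
  have hq : ∀ x, q (Function.surjInv (aeval_cyclotomicInteger_surjective r) x) = x :=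
    Function.surjInv_eq _
  have key : ∀ p p', q p = q p' → p • w = p' • w := by
    intro p p' hpp
    obtain ⟨a, ha⟩ := (aeval_cyclotomicInteger_eq_zero_iff r (p - p')).1
      (by rw [map_sub]; exact sub_eq_zero.2 hpp)
    rw [← sub_eq_zero, ← sub_smul, ha, mul_comm, mul_smul, hw, smul_zero]
  let g : 𝓞 (CyclotomicField r ℚ) →+ P :=
    { toFun := fun x => Function.surjInv (aeval_cyclotomicInteger_surjective r) x • w
      map_zero' := by
        rw [key _ 0 (by rw [hq]; simp [q]), zero_smul]
      map_add' := fun x y => by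
        rw [← add_smul]
        exact key _ _ (by rw [hq]; simp only [q, map_add]; congr 1 <;> exact (hq _).symm) }
  exact ⟨g.toIntLinearMap, fun p => key _ _ (hq _)⟩

end RingOfIntegers

/-- Every free `ℤ`-module with an automorphism of finite order is isogenous to a direct sum of
cyclotomic rings of integers. -/
theorem exists_cyclotomic_isogeny {M : Type*} [AddCommGroup M] [Module.Finite ℤ M]
    (σ : M ≃ₗ[ℤ] M) (hσ : ∃ n : ℕ, 0 < n ∧ σ ^ n = 1) :
    ∃ (m : ℕ) (r : Fin m → ℕ+)
      (ψ : ((i : Fin m) → NumberField.RingOfIntegers (CyclotomicField (r i) ℚ)) →ₗ[ℤ] M),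
      Function.Injective ψ ∧ Finite (M ⧸ LinearMap.range ψ) ∧
      ∀ x, ψ (fun i => cyclotomicInteger (r i) * x i) = σ (ψ x) := by
  obtain ⟨n, hn, hσn⟩ := hσ
  let : Module ℤ[X] M :=
    Module.compHom M (aeval (R := ℤ) (σ : Module.End ℤ M)).toRingHom
  have hsmul : ∀ (p : ℤ[X]) (v : M), p • v = aeval (σ : Module.End ℤ M) p v := fun _ _ => rfl
  have hX : ∀ v : M, (X : ℤ[X]) • v = σ v := fun v => by simp [hsmul]
  have hXn : ∀ v : M, (X ^ n - 1 : ℤ[X]) • v = 0 := fun v => by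
    have hpow : ∀ k : ℕ, (X ^ k : ℤ[X]) • v = (σ ^ k) v := by
      intro k
      induction k with
      | zero => simp
      | succ k ih => rw [pow_succ', mul_smul, ih, hX, pow_succ']; rfl
    rw [sub_smul, hpow, hσn, one_smul]
    simp
  obtain ⟨m, r, w, hw, htop⟩ := exists_isCyclotomicFamily_intSaturation_eq_top hn hXn
  choose g hg using fun i => exists_linearMap_aeval_cyclotomicInteger (r i) (hw.1 i)
  let ψ : ((i : Fin m) → NumberField.RingOfIntegers (CyclotomicField (r i) ℚ)) →ₗ[ℤ] M :=
    ∑ i, (g i).comp (LinearMap.proj i)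
  have hψ : ∀ p : Fin m → ℤ[X],
      ψ (fun i => aeval (cyclotomicInteger (r i)) (p i)) = ∑ i, p i • w i := fun p => by
    simp [ψ, hg]
  have hsurj : ∀ x : (i : Fin m) → NumberField.RingOfIntegers (CyclotomicField (r i) ℚ),
      ∃ p : Fin m → ℤ[X], x = fun i => aeval (cyclotomicInteger (r i)) (p i) := fun x => by
    choose p hp using fun i => aeval_cyclotomicInteger_surjective (r i) (x i)
    exact ⟨p, funext fun i => (hp i).symm⟩
  refine ⟨m, r, ψ, ?_, ?_, ?_⟩
  · rw [injective_iff_map_eq_zero]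
    intro x hx
    obtain ⟨p, rfl⟩ := hsurj x
    rw [hψ] at hx
    exact funext fun i => (aeval_cyclotomicInteger_eq_zero_iff (r i) (p i)).2 (hw.2 p hx i)
  · have htors : Module.IsTorsion ℤ (M ⧸ LinearMap.range ψ) := by
      intro x
      obtain ⟨v, rfl⟩ := Submodule.Quotient.mk_surjective _ x
      obtain ⟨c, hc, hcv⟩ := Submodule.mem_intSaturation.1 (htop ▸ Submodule.mem_top (x := v))
      obtain ⟨p, hp⟩ := (Submodule.mem_span_range_iff_exists_fun ℤ[X]).1 hcv
      refine ⟨⟨c, mem_nonZeroDivisors_of_ne_zero hc⟩, ?_⟩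
      change c • (Submodule.Quotient.mk v : M ⧸ LinearMap.range ψ) = 0
      rw [← Submodule.Quotient.mk_smul, Submodule.Quotient.mk_eq_zero, ← hp, ← hψ]
      exact LinearMap.mem_range_self _ _
    exact Module.finite_of_fg_torsion _ htors
  · intro x
    obtain ⟨p, rfl⟩ := hsurj x
    have hmul : (fun i => cyclotomicInteger (r i) * aeval (cyclotomicInteger (r i)) (p i)) =
        fun i => aeval (cyclotomicInteger (r i)) (X * p i) := by
      simp
    rw [hmul, hψ, hψ, ← hX, Finset.smul_sum]
    simp only [mul_smul]

/-- A bilinear pairing of free `ℤ`-modules with trivial left kernel bounds the rank of the left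
factor. -/
theorem finrank_le_of_injective_pairing {M N : Type*}
    [AddCommGroup M] [AddCommGroup N] [Module.Free ℤ N] [Module.Finite ℤ N]
    (B : M →ₗ[ℤ] N →ₗ[ℤ] ℤ) (hB : Function.Injective B) :
    Module.finrank ℤ M ≤ Module.finrank ℤ N := by
  rw [← Module.finrank_linearMap_self ℤ ℤ N]
  exact LinearMap.finrank_le_finrank_of_injective hB

/-- Every nondegenerate `Γ`-equivariant lattice pairing `B : M × N → ℤ`
between free `Γ`-modules is isogenous to `(R, Hom_ℤ(R, ℤ))` with the natural evaluation
pairing, where `R` is a finite direct sum of rings of integers `ℤ[ζ_{r_i}]` of cyclotomic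
fields with the automorphism `δ` acting by multiplication by the `ζ_{r_i}`.  The condition
`ψ₂ (σ_N y) = ψ₂ y ∘ δ⁻¹` is recorded equivalently as `ψ₂ (σ_N y) (δ x) = ψ₂ y x`. -/
theorem stmt_5 {M N : Type*}
    [AddCommGroup M] [Module ℤ M] [Module.Free ℤ M] [Module.Finite ℤ M]
    [AddCommGroup N] [Module ℤ N] [Module.Free ℤ N] [Module.Finite ℤ N]
    (σM : M ≃ₗ[ℤ] M) (σN : N ≃ₗ[ℤ] N)
    (hσM : ∃ n : ℕ, 0 < n ∧ σM ^ n = 1) (hσN : ∃ n : ℕ, 0 < n ∧ σN ^ n = 1)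
    (B : M →ₗ[ℤ] N →ₗ[ℤ] ℤ)
    (hBeq : ∀ x y, B (σM x) (σN y) = B x y)
    (hBnd₁ : ∀ x : M, x ≠ 0 → ∃ y, B x y ≠ 0)
    (hBnd₂ : ∀ y : N, y ≠ 0 → ∃ x, B x y ≠ 0) :
    ∃ (m : ℕ) (r : Fin m → ℕ+)
      (ζ : (i : Fin m) → NumberField.RingOfIntegers (CyclotomicField (r i) ℚ)),
      (∀ i, IsPrimitiveRoot (ζ i) (r i : ℕ)) ∧
      ∃ (ψ₁ : ((i : Fin m) → NumberField.RingOfIntegers (CyclotomicField (r i) ℚ)) →ₗ[ℤ] M)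
        (ψ₂ : N →ₗ[ℤ]
          (((i : Fin m) → NumberField.RingOfIntegers (CyclotomicField (r i) ℚ)) →ₗ[ℤ] ℤ)),
        Function.Injective ψ₁ ∧ Finite (M ⧸ LinearMap.range ψ₁) ∧
        Function.Injective ψ₂ ∧
        Finite ((((i : Fin m) → NumberField.RingOfIntegers (CyclotomicField (r i) ℚ)) →ₗ[ℤ] ℤ)
          ⧸ LinearMap.range ψ₂) ∧
        (∀ x, ψ₁ (fun i => ζ i * x i) = σM (ψ₁ x)) ∧
        (∀ y x, ψ₂ (σN y) (fun i => ζ i * x i) = ψ₂ y x) ∧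
        (∀ x y, B (ψ₁ x) y = ψ₂ y x) := by
  obtain rfl := Subsingleton.elim ‹Module ℤ M› (AddCommGroup.toIntModule M)
  obtain rfl := Subsingleton.elim ‹Module ℤ N› (AddCommGroup.toIntModule N)
  obtain ⟨m, r, ψ, hinj, hfin, hequiv⟩ := exists_cyclotomic_isogeny σM hσM
  have hB : Function.Injective B := by
    rw [injective_iff_map_eq_zero]
    intro x hx
    by_contra hx0
    obtain ⟨y, hy⟩ := hBnd₁ x hx0
    exact hy (by rw [hx, LinearMap.zero_apply])
  have hBflip : Function.Injective B.flip := by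
    rw [injective_iff_map_eq_zero]
    intro y hy
    by_contra hy0
    obtain ⟨x, hx⟩ := hBnd₂ y hy0
    exact hx (by rw [← LinearMap.flip_apply, hy, LinearMap.zero_apply])
  have hrank : Module.finrank ℤ N = Module.finrank ℤ M :=
    le_antisymm (finrank_le_of_injective_pairing _ hBflip) (finrank_le_of_injective_pairing _ hB)
  have hψ₂ : Function.Injective (B.comp ψ).flip := by
    rw [injective_iff_map_eq_zero]
    intro y hy
    apply hBflip
    rw [map_zero]
    ext x
    have hcard : Nat.card (M ⧸ LinearMap.range ψ) • x ∈ LinearMap.range ψ := by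
      rw [← Submodule.Quotient.mk_eq_zero, Submodule.Quotient.mk_smul]
      exact card_nsmul_eq_zero'
    obtain ⟨z, hz⟩ := hcard
    have hzero : Nat.card (M ⧸ LinearMap.range ψ) • B x y = 0 := by
      rw [← LinearMap.smul_apply, ← map_nsmul, ← hz]
      exact LinearMap.congr_fun hy z
    exact (smul_eq_zero.1 hzero).resolve_left Nat.card_pos.ne'
  refine ⟨m, r, fun i => cyclotomicInteger (r i), fun i => isPrimitiveRoot_cyclotomicInteger _,
    ψ, (B.comp ψ).flip, hinj, hfin, hψ₂, ?_, hequiv, ?_, fun _ _ => rfl⟩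
  · rw [Submodule.finiteQuotient_iff] at hfin ⊢
    rw [LinearMap.finrank_range_of_inj hinj] at hfin
    rw [LinearMap.finrank_range_of_inj hψ₂, Module.finrank_linearMap_self, hfin, hrank]
  · intro y x
    simp only [LinearMap.flip_apply, LinearMap.comp_apply, hequiv, hBeq]
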